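/- Let α, β, γ, μ be complex numbers and ε a real number with Re γ > Re α > 0, Re β > 0, 0 < ε < min(Re α, Re β) and 0 < Im μ < 2π. Then the integral ∫_{1}^{∞} t^{−β} (t−1)^{α−1} (t−e^{μ})^{β−γ} dt converges absolutely and B(α,β,γ;μ,ε) = (1−e^{μ})^{γ−α−β} · (Γ(β)/Γ(γ−α)) · ∫_{1}^{∞} t^{−β} (t−1)^{α−1} (t−e^{μ})^{β−γ} dt. (Here 1−e^{μ} and t−e^{μ} for t ≥ 1 never lie in (−∞,0], so the principal powers are well defined.) -/

import Mathlib

open Complex MeasureTheory Real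

/-- The Barnes integral `B(α,β,γ;μ,ε)`:
`(1/(2π)) ∫_{−∞}^{∞} e^{(−ε+iy)(μ−πi)} Γ(ε−iy) Γ(α−ε+iy) Γ(β−ε+iy) / Γ(γ−ε+iy) dy`. -/
noncomputable def BarnesB (α β γ μ : ℂ) (ε : ℝ) : ℂ :=
  (1 / (2 * (π : ℂ))) * ∫ y : ℝ,
    Complex.exp ((-(ε : ℂ) + Complex.I * (y : ℂ)) * (μ - (π : ℂ) * Complex.I)) *
      Complex.Gamma ((ε : ℂ) - Complex.I * (y : ℂ)) *
      Complex.Gamma (α - (ε : ℂ) + Complex.I * (y : ℂ)) *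
      Complex.Gamma (β - (ε : ℂ) + Complex.I * (y : ℂ)) /
      Complex.Gamma (γ - (ε : ℂ) + Complex.I * (y : ℂ))

open Set Filter Topology

/-- An integral depending on a complex parameter is holomorphic if its integrand is and is locally
dominated by integrable functions. -/
theorem differentiableOn_integral_of_locally_dominated {X : Type*} [MeasurableSpace X]
    {ν : Measure X} {U : Set ℂ} (hU : IsOpen U) {F : ℂ → X → ℂ}
    (hm : ∀ z ∈ U, AEStronglyMeasurable (F z) ν)
    (hd : ∀ᵐ x ∂ν, DifferentiableOn ℂ (fun z => F z x) U)
    (hb : ∀ z₀ ∈ U, ∃ V ∈ 𝓝 z₀, ∃ bound : X → ℝ, Integrable bound ν ∧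
      ∀ᵐ x ∂ν, ∀ z ∈ V, ‖F z x‖ ≤ bound x) :
    DifferentiableOn ℂ (fun z => ∫ x, F z x ∂ν) U := by
  intro z₀ hz₀
  obtain ⟨V, hV, bound, hbi, hbound⟩ := hb z₀ hz₀
  obtain ⟨r, hr, hrs⟩ := Metric.nhds_basis_closedBall.mem_iff.1
    (Filter.inter_mem hV (hU.mem_nhds hz₀))
  have hr2 : 0 < r / 2 := by positivity
  have hsub : ∀ z ∈ Metric.ball z₀ (r / 2), ∀ w ∈ Metric.closedBall z (r / 2),
      w ∈ V ∩ U := by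
    intro z hz w hw
    apply hrs
    rw [Metric.mem_closedBall] at *
    rw [Metric.mem_ball] at hz
    linarith [dist_triangle w z z₀]
  have hball : ∀ z ∈ Metric.ball z₀ (r / 2), z ∈ V ∩ U := fun z hz =>
    hsub z hz z (Metric.mem_closedBall_self hr2.le)
  have hderiv : ∀ᵐ x ∂ν, ∀ z ∈ Metric.ball z₀ (r / 2),
      HasDerivAt (fun z => F z x) (deriv (fun z => F z x) z) z := by
    filter_upwards [hd] with x hx z hz
    exact (hx.differentiableAt (hU.mem_nhds (hball z hz).2)).hasDerivAt
  have hmem : z₀ ∈ Metric.ball z₀ (r / 2) := Metric.mem_ball_self hr2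
  have key := hasDerivAt_integral_of_dominated_loc_of_deriv_le (μ := ν) (F := F) (x₀ := z₀)
    (F' := fun z x => deriv (fun z => F z x) z) (bound := fun x => bound x / (r / 2))
    (Metric.ball_mem_nhds z₀ hr2) ?_ ?_ ?_ ?_ (hbi.div_const _) hderiv
  · exact key.2.differentiableAt.differentiableWithinAt
  · filter_upwards [hU.mem_nhds hz₀] with z hz using hm z hz
  · refine hbi.mono' (hm z₀ hz₀) ?_
    filter_upwards [hbound] with x hx using hx z₀ (hball z₀ hmem).1
  · obtain ⟨u, hu0, hu⟩ : ∃ u : ℕ → ℂ, (∀ n, u n ∈ Metric.ball z₀ (r / 2) ∧ u n ≠ z₀) ∧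
        Tendsto u atTop (𝓝 z₀) := by
      have : (𝓝[≠] z₀).NeBot := inferInstance
      obtain ⟨u, hu⟩ := exists_seq_tendsto (𝓝[≠] z₀)
      have hev : ∀ᶠ n in atTop, u n ∈ Metric.ball z₀ (r / 2) ∧ u n ≠ z₀ := by
        have h1 := hu.eventually (mem_nhdsWithin_of_mem_nhds (Metric.ball_mem_nhds z₀ hr2))
        have h2 := hu.eventually (self_mem_nhdsWithin (s := {z₀}ᶜ))
        filter_upwards [h1, h2] with n h1 h2 using ⟨h1, h2⟩
      obtain ⟨N, hN⟩ := eventually_atTop.1 hev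
      exact ⟨fun n => u (n + N), fun n => hN _ (by omega),
        (hu.mono_right nhdsWithin_le_nhds).comp (tendsto_add_atTop_nat N)⟩
    refine aestronglyMeasurable_of_tendsto_ae (u := atTop)
      (f := fun n x => slope (fun z => F z x) z₀ (u n)) (fun n => ?_) ?_
    · simp only [slope_def_field]
      exact ((hm _ (hball _ (hu0 n).1).2).sub (hm _ hz₀)).mul
        (aestronglyMeasurable_const (b := (u n - z₀)⁻¹))
    · filter_upwards [hderiv] with x hx
      refine (hasDerivAt_iff_tendsto_slope.1 (hx z₀ hmem)).comp ?_
      exact tendsto_nhdsWithin_iff.2 ⟨hu, Eventually.of_forall fun n => (hu0 n).2⟩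
  · filter_upwards [hbound, hd] with x hx hdx z hz
    refine Complex.norm_deriv_le_of_forall_mem_sphere_norm_le hr2 ?_ ?_
    · refine (hdx.mono fun w hw => (hsub z hz w ?_).2).diffContOnCl
      rwa [closure_ball _ hr2.ne'] at hw
    · intro w hw
      exact hx w (hsub z hz w (Metric.sphere_subset_closedBall hw)).1

/-- The identity theorem for two holomorphic functions agreeing along a real line. -/
theorem eqOn_of_eq_on_real_line {U : Set ℂ} (hU : IsOpen U) (hpre : IsPreconnected U)
    {f g : ℂ → ℂ} (hf : DifferentiableOn ℂ f U) (hg : DifferentiableOn ℂ g U) {z₀ v : ℂ}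
    (hz₀ : z₀ ∈ U) (hv : v ≠ 0) (h : ∀ t : ℝ, z₀ + t * v ∈ U → f (z₀ + t * v) = g (z₀ + t * v)) :
    EqOn f g U := by
  refine (hf.analyticOnNhd hU).eqOn_of_preconnected_of_frequently_eq (hg.analyticOnNhd hU) hpre
    hz₀ ?_
  have hc : Tendsto (fun t : ℝ => z₀ + t * v) (𝓝 0) (𝓝 z₀) := by
    have : Continuous (fun t : ℝ => z₀ + t * v) := by fun_prop
    simpa using this.tendsto 0
  have hc' : Tendsto (fun t : ℝ => z₀ + t * v) (𝓝[≠] 0) (𝓝[≠] z₀) := by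
    refine tendsto_nhdsWithin_iff.2 ⟨hc.mono_left nhdsWithin_le_nhds, ?_⟩
    filter_upwards [self_mem_nhdsWithin] with t ht
    simpa [hv] using ht
  refine hc'.frequently (Eventually.frequently ?_)
  filter_upwards [(hc.mono_left nhdsWithin_le_nhds).eventually (hU.mem_nhds hz₀)] with t ht
    using h t ht

/-- The Laplace transform of `t ^ (a - 1)`. -/
theorem integral_cpow_mul_exp_neg_complex_mul {a r : ℂ} (ha : 0 < a.re) (hr : 0 < r.re) :
    ∫ t : ℝ in Ioi 0, (t : ℂ) ^ (a - 1) * Complex.exp (-(r * t)) =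
      r ^ (-a) * Complex.Gamma a := by
  have hU : IsOpen {z : ℂ | 0 < z.re} := isOpen_lt continuous_const Complex.continuous_re
  have hmeas : ∀ z : ℂ, AEStronglyMeasurable
      (fun t : ℝ => (t : ℂ) ^ (a - 1) * Complex.exp (-(z * t))) (volume.restrict (Ioi 0)) := by
    intro z
    refine ContinuousOn.aestronglyMeasurable ?_ measurableSet_Ioi
    refine ContinuousOn.mul (fun t ht => ?_) (by fun_prop)
    exact (Complex.continuousAt_ofReal_cpow_const t _ (Or.inr (ne_of_gt ht))).continuousWithinAt
  have hd : DifferentiableOn ℂ (fun z : ℂ => ∫ t : ℝ in Ioi 0,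
      (t : ℂ) ^ (a - 1) * Complex.exp (-(z * t))) {z : ℂ | 0 < z.re} := by
    refine differentiableOn_integral_of_locally_dominated hU (fun z _ => hmeas z)
      (Eventually.of_forall fun t => by fun_prop) fun z₀ hz₀ => ?_
    have hz₀' : 0 < z₀.re := hz₀
    refine ⟨{z | z₀.re / 2 < z.re}, (isOpen_lt continuous_const Complex.continuous_re).mem_nhds
      (by simpa using by linarith), fun t => t ^ (a.re - 1) * rexp (-(z₀.re / 2) * t ^ (1 : ℝ)),
      integrableOn_rpow_mul_exp_neg_mul_rpow (by linarith) one_pos (by linarith), ?_⟩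
    filter_upwards [ae_restrict_mem measurableSet_Ioi] with t ht z hz
    have ht : 0 < t := ht
    have hz : z₀.re / 2 < z.re := hz
    rw [norm_mul, Complex.norm_cpow_eq_rpow_re_of_pos ht, Complex.norm_exp, rpow_one]
    simp only [sub_re, one_re, neg_re, re_mul_ofReal]
    gcongr
    nlinarith
  have hd2 : DifferentiableOn ℂ (fun z : ℂ => z ^ (-a) * Complex.Gamma a) {z : ℂ | 0 < z.re} := by
    intro z hz
    exact ((differentiableAt_id.cpow_const (Or.inl hz)).mul_const _).differentiableWithinAt
  have hpre : IsPreconnected {z : ℂ | 0 < z.re} := (convex_halfSpace_re_gt 0).isPreconnected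
  refine eqOn_of_eq_on_real_line hU hpre hd hd2 (z₀ := 1) (v := 1) (by simp) one_ne_zero
    (fun t ht => ?_) hr
  have ht' : 0 < 1 + t := by simpa using ht
  have := Complex.integral_cpow_mul_exp_neg_mul_Ioi ha ht'
  rw [one_div, Complex.inv_cpow _ _ (by
    rw [Complex.arg_ofReal_of_nonneg ht'.le]; exact Real.pi_pos.ne), ← Complex.cpow_neg] at this
  simpa using this

/-- Exponential decay of the Gamma function along vertical lines. -/
theorem exists_norm_Gamma_le {σ θ : ℝ} (hσ : 0 < σ) (hθ0 : 0 ≤ θ) (hθ : θ < π / 2) :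
    ∃ C : ℝ, 0 ≤ C ∧ ∀ a : ℂ, a.re = σ → ‖Complex.Gamma a‖ ≤ C * rexp (-θ * |a.im|) := by
  have hcos : 0 < Real.cos θ := Real.cos_pos_of_mem_Ioo ⟨by linarith [Real.pi_pos], hθ⟩
  set C := ∫ t : ℝ in Ioi 0, t ^ (σ - 1) * rexp (-(Real.cos θ * t)) with hC
  have aux : ∀ (a : ℂ) (φ : ℝ), a.re = σ → |φ| < π / 2 → Real.cos φ = Real.cos θ →
      ‖Complex.Gamma a‖ ≤ C * rexp (-φ * a.im) := by
    intro a φ ha hφ hφc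
    have hφ' := abs_lt.1 hφ
    have hpi := Real.pi_pos
    set r : ℂ := Complex.exp (φ * I) with hr
    have hre : r.re = Real.cos θ := by rw [hr, Complex.exp_ofReal_mul_I_re, hφc]
    have hlog : Complex.log r = φ * I := Complex.log_exp (by simp; linarith) (by simp; linarith)
    have h := integral_cpow_mul_exp_neg_complex_mul (a := a) (r := r) (ha ▸ hσ) (hre ▸ hcos)
    have hn : ‖r ^ (-a)‖ = rexp (φ * a.im) := by
      rw [Complex.cpow_def_of_ne_zero (Complex.exp_ne_zero _), hlog, Complex.norm_exp]
      simp
    have hle : ‖∫ t : ℝ in Ioi 0, (t : ℂ) ^ (a - 1) * Complex.exp (-(r * t))‖ ≤ C := by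
      refine (norm_integral_le_integral_norm _).trans_eq ?_
      refine setIntegral_congr_fun measurableSet_Ioi fun t ht => ?_
      have ht : 0 < t := ht
      simp only [norm_mul, Complex.norm_cpow_eq_rpow_re_of_pos ht, Complex.norm_exp, sub_re,
        one_re, neg_re, re_mul_ofReal, ha, hre]
    rw [h, norm_mul, hn] at hle
    calc ‖Complex.Gamma a‖ = rexp (-φ * a.im) * (rexp (φ * a.im) * ‖Complex.Gamma a‖) := by
          rw [← mul_assoc, ← Real.exp_add]; simp
      _ ≤ rexp (-φ * a.im) * C := by gcongr
      _ = _ := mul_comm _ _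
  refine ⟨C, ?_, fun a ha => ?_⟩
  · exact setIntegral_nonneg measurableSet_Ioi fun t ht =>
      mul_nonneg (Real.rpow_nonneg (le_of_lt ht) _) (Real.exp_pos _).le
  · rcases le_total 0 a.im with h | h
    · rw [abs_of_nonneg h]
      exact aux a θ ha (by rwa [abs_of_nonneg hθ0]) rfl
    · rw [abs_of_nonpos h]
      have := aux a (-θ) ha (by rwa [abs_neg, abs_of_nonneg hθ0]) (Real.cos_neg θ)
      simpa using this

theorem integrable_exp_neg_mul_abs {δ : ℝ} (hδ : 0 < δ) :
    Integrable (fun y : ℝ => rexp (-δ * |y|)) := by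
  have h₁ : IntegrableOn (fun y : ℝ => rexp (-δ * |y|)) (Ioi 0) := by
    refine (integrableOn_exp_mul_Ioi (a := -δ) (by linarith) 0).congr_fun (fun y hy => ?_)
      measurableSet_Ioi
    simp [abs_of_pos (mem_Ioi.1 hy)]
  have h₂ : IntegrableOn (fun y : ℝ => rexp (-δ * |y|)) (Iic 0) := by
    refine (integrableOn_exp_mul_Iic (a := δ) hδ 0).congr_fun (fun y hy => ?_)
      measurableSet_Iic
    simp [abs_of_nonpos (mem_Iic.1 hy)]
  simpa [Iic_union_Ioi] using h₂.union h₁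

theorem exists_norm_Gamma_mul_Gamma_le {β : ℂ} {ε θ : ℝ} (hε : 0 < ε) (hβ : ε < β.re)
    (hθ0 : 0 ≤ θ) (hθ : θ < π / 2) :
    ∃ C : ℝ, 0 ≤ C ∧ ∀ y : ℝ, ‖Complex.Gamma (ε - I * y) * Complex.Gamma (β - ε + I * y)‖ ≤
      C * rexp (-(2 * θ) * |y|) := by
  obtain ⟨C₁, hC₁, h₁⟩ := exists_norm_Gamma_le hε hθ0 hθ
  obtain ⟨C₂, hC₂, h₂⟩ := exists_norm_Gamma_le (sub_pos.2 hβ) hθ0 hθ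
  refine ⟨C₁ * C₂ * rexp (θ * |β.im|), by positivity, fun y => ?_⟩
  have k₁ := h₁ (ε - I * y) (by simp)
  have k₂ := h₂ (β - ε + I * y) (by simp)
  simp only [sub_im, add_im, ofReal_im, mul_im, I_re, I_im, ofReal_re, zero_mul, one_mul,
    zero_add, zero_sub, abs_neg, sub_zero] at k₁ k₂
  rw [norm_mul]
  calc _ ≤ (C₁ * rexp (-θ * |y|)) * (C₂ * rexp (-θ * |β.im + y|)) := by gcongr
    _ ≤ (C₁ * rexp (-θ * |y|)) * (C₂ * rexp (θ * |β.im| + -θ * |y|)) := by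
        gcongr
        have : |y| ≤ |β.im + y| + |β.im| := by
          simpa using abs_sub (β.im + y) β.im
        nlinarith
    _ = _ := by
        rw [Real.exp_add, show -(2 * θ) * |y| = -θ * |y| + -θ * |y| by ring, Real.exp_add]
        ring

theorem ofReal_mul_cpow {r : ℝ} (hr : 0 < r) {w : ℂ} (hw : w ≠ 0) (c : ℂ) :
    ((r : ℂ) * w) ^ c = (r : ℂ) ^ c * w ^ c := by
  have hr' : (r : ℂ) ≠ 0 := ofReal_ne_zero.2 hr.ne'
  rw [Complex.cpow_def_of_ne_zero (mul_ne_zero hr' hw), Complex.cpow_def_of_ne_zero hr',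
    Complex.cpow_def_of_ne_zero hw, Complex.log_ofReal_mul hr hw, add_mul, Complex.exp_add,
    Complex.ofReal_log hr.le]

theorem one_sub_mul_ofReal_mem_slitPlane {z : ℂ} (hz : 1 - z ∈ slitPlane) {v : ℝ}
    (hv : v ∈ Icc (0 : ℝ) 1) : 1 - z * v ∈ slitPlane := by
  have := Complex.starConvex_one_slitPlane.add_smul_mem (y := -z)
    (by simpa [sub_eq_add_neg] using hz) hv.1 hv.2
  simpa [sub_eq_add_neg, mul_comm] using this

theorem ofReal_sub_mem_slitPlane {z : ℂ} (hz : 1 - z ∈ slitPlane) {t : ℝ} (ht : 1 ≤ t) :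
    (t : ℂ) - z ∈ slitPlane := by
  have := Complex.starConvex_one_slitPlane.add_smul_mem (y := -z)
    (by simpa [sub_eq_add_neg] using hz)
    (inv_nonneg.2 (zero_le_one.trans ht)) (inv_le_one_of_one_le₀ ht)
  have ht0 : 0 < t := by linarith
  have h2 : (t : ℂ) - z = (t : ℝ) • (1 + t⁻¹ • -z) := by
    simp only [Complex.real_smul, ofReal_inv]
    field_simp [ofReal_ne_zero.2 ht0.ne']
    ring
  rw [h2, Complex.real_smul]
  rw [Complex.mem_slitPlane_iff] at this ⊢
  rw [Complex.re_ofReal_mul, Complex.im_ofReal_mul]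
  exact this.imp (fun h => mul_pos ht0 h) (fun h => mul_ne_zero ht0.ne' h)

/-- A locally uniform bound for `(t - z) ^ c` on `t ≥ 1`, away from the cut. -/
theorem exists_norm_ofReal_sub_cpow_le (c : ℂ) {z₀ : ℂ} (hz₀ : 1 - z₀ ∈ slitPlane) :
    ∃ V ∈ 𝓝 z₀, ∃ C : ℝ, 0 ≤ C ∧ ∀ z ∈ V, ∀ t : ℝ, 1 ≤ t →
      ‖((t : ℂ) - z) ^ c‖ ≤ C * t ^ c.re := by
  have hopen : IsOpen {z : ℂ | 1 - z ∈ slitPlane} :=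
    isOpen_slitPlane.preimage (by fun_prop : Continuous fun z : ℂ => 1 - z)
  obtain ⟨r, hr, hsub⟩ := Metric.nhds_basis_closedBall.mem_iff.1 (hopen.mem_nhds hz₀)
  have hK : IsCompact (Metric.closedBall z₀ r ×ˢ Icc (0 : ℝ) 1) :=
    (isCompact_closedBall z₀ r).prod isCompact_Icc
  obtain ⟨C, hC⟩ := hK.exists_bound_of_continuousOn
    (f := fun p : ℂ × ℝ => (1 - p.1 * p.2) ^ c) (by
      refine ContinuousOn.cpow_const (by fun_prop) fun p hp => ?_
      exact one_sub_mul_ofReal_mem_slitPlane (hsub hp.1) hp.2)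
  refine ⟨Metric.closedBall z₀ r, Metric.closedBall_mem_nhds z₀ hr, C,
    (norm_nonneg _).trans (hC (z₀, 0) ⟨Metric.mem_closedBall_self hr.le, by simp⟩),
    fun z hz t ht => ?_⟩
  have ht0 : 0 < t := by linarith
  have hv : t⁻¹ ∈ Icc (0 : ℝ) 1 := ⟨by positivity, inv_le_one_of_one_le₀ ht⟩
  have heq : (t : ℂ) - z = t * (1 - z * (t⁻¹ : ℝ)) := by
    push_cast
    field_simp [ofReal_ne_zero.2 ht0.ne']
  rw [heq, ofReal_mul_cpow ht0
    (Complex.slitPlane_ne_zero (one_sub_mul_ofReal_mem_slitPlane (hsub hz) hv)), norm_mul,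
    Complex.norm_cpow_eq_rpow_re_of_pos ht0, mul_comm]
  gcongr
  exact hC (z, t⁻¹) ⟨hz, hv⟩

theorem ofReal_cpow_eq_exp {r : ℝ} (hr : 0 < r) (s : ℂ) :
    (r : ℂ) ^ s = Complex.exp (s * (Real.log r : ℝ)) := by
  rw [Complex.cpow_def_of_ne_zero (ofReal_ne_zero.2 hr.ne'), Complex.ofReal_log hr.le, mul_comm]

theorem image_mobius_Ioi {x : ℝ} (hx : 0 ≤ x) :
    (fun t : ℝ => (t - 1) / (t + x)) '' Ioi 1 = Ioo 0 1 := by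
  ext u
  constructor
  · rintro ⟨t, ht, rfl⟩
    have ht : 1 < t := ht
    exact ⟨div_pos (by linarith) (by linarith), (div_lt_one (by linarith)).2 (by linarith)⟩
  · rintro ⟨h0, h1⟩
    have h1' : 0 < 1 - u := by linarith
    refine ⟨(1 + x * u) / (1 - u), ?_, ?_⟩
    · rw [mem_Ioi, lt_div_iff₀ h1']
      nlinarith
    · have : 1 + x * u + x * (1 - u) ≠ 0 := by ring_nf; positivity
      simp only
      field_simp
      ring

theorem injOn_mobius {x : ℝ} (hx : 0 ≤ x) :
    InjOn (fun t : ℝ => (t - 1) / (t + x)) (Ioi 1) := by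
  intro t ht s hs h
  have ht : 1 < t := ht
  have hs : 1 < s := hs
  simp only at h
  rw [div_eq_div_iff (by linarith) (by linarith)] at h
  have : (1 + x) * (t - s) = 0 := by linarith
  rcases mul_eq_zero.1 this with h | h <;> linarith

theorem hasDerivWithinAt_mobius {x : ℝ} (hx : 0 ≤ x) {t : ℝ} (ht : t ∈ Ioi 1) :
    HasDerivWithinAt (fun t : ℝ => (t - 1) / (t + x)) ((1 + x) / (t + x) ^ 2) (Ioi 1) t := by
  have ht : 1 < t := ht
  have h0 : t + x ≠ 0 := by linarith
  have := ((hasDerivAt_id t).sub_const 1).div ((hasDerivAt_id t).add_const x) h0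
  refine (this.congr_deriv ?_).hasDerivWithinAt
  simp only [id]
  ring

theorem euler_integrand_mobius (α β γ : ℂ) {x t : ℝ} (hx : 0 ≤ x) (ht : t ∈ Ioi 1) :
    |(1 + x) / (t + x) ^ 2| • ((((t - 1) / (t + x) : ℝ) : ℂ) ^ (α - 1) *
      (1 - (((t - 1) / (t + x) : ℝ) : ℂ)) ^ (γ - α - 1) *
      (1 + x * (((t - 1) / (t + x) : ℝ) : ℂ)) ^ (-β)) =
    (1 + x : ℂ) ^ (γ - α - β) *
      ((t : ℂ) ^ (-β) * ((t : ℂ) - 1) ^ (α - 1) * ((t : ℂ) + x) ^ (β - γ)) := by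
  have ht : 1 < t := ht
  have hA : 0 < t - 1 := by linarith
  have hB : 0 < t + x := by linarith
  have hD : 0 < 1 + x := by linarith
  have hT : 0 < t := by linarith
  have e1 : (1 - (((t - 1) / (t + x) : ℝ) : ℂ)) = (((1 + x) / (t + x) : ℝ) : ℂ) := by
    rw [← ofReal_one, ← ofReal_sub]
    congr 1
    field_simp
    ring
  have e2 : (1 + x * (((t - 1) / (t + x) : ℝ) : ℂ)) = ((t * (1 + x) / (t + x) : ℝ) : ℂ) := by
    rw [← ofReal_one, ← ofReal_mul, ← ofReal_add]
    congr 1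
    field_simp
    ring
  have e3 : (1 + x : ℂ) = ((1 + x : ℝ) : ℂ) := by push_cast; rfl
  have e4 : (t : ℂ) - 1 = ((t - 1 : ℝ) : ℂ) := by push_cast; rfl
  have e5 : (t : ℂ) + x = ((t + x : ℝ) : ℂ) := by push_cast; rfl
  have e6 : |(1 + x) / (t + x) ^ 2| = rexp (Real.log (1 + x) - 2 * Real.log (t + x)) := by
    rw [abs_of_pos (by positivity), Real.exp_sub, Real.exp_log hD, two_mul, Real.exp_add,
      Real.exp_log hB, sq]
  rw [e1, e2, e3, e4, e5, e6, Complex.real_smul, ofReal_cpow_eq_exp (div_pos hA hB),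
    ofReal_cpow_eq_exp (div_pos hD hB), ofReal_cpow_eq_exp (div_pos (mul_pos hT hD) hB),
    ofReal_cpow_eq_exp hA, ofReal_cpow_eq_exp hB, ofReal_cpow_eq_exp hD, ofReal_cpow_eq_exp hT,
    Real.log_div hA.ne' hB.ne', Real.log_div hD.ne' hB.ne',
    Real.log_div (mul_pos hT hD).ne' hB.ne', Real.log_mul hT.ne' hD.ne', ofReal_exp]
  simp only [← Complex.exp_add]
  congr 1
  push_cast
  ring

/-- The Euler transformation of the hypergeometric integral, for a nonnegative argument. -/
theorem euler_integral_eq_loop_integral (α β γ : ℂ) {x : ℝ} (hx : 0 ≤ x) :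
    ∫ u : ℝ in Ioo 0 1, (u : ℂ) ^ (α - 1) * (1 - (u : ℂ)) ^ (γ - α - 1) *
        (1 + x * (u : ℂ)) ^ (-β) =
      (1 + x : ℂ) ^ (γ - α - β) * ∫ t : ℝ in Ioi 1,
        (t : ℂ) ^ (-β) * ((t : ℂ) - 1) ^ (α - 1) * ((t : ℂ) + x) ^ (β - γ) := by
  rw [← image_mobius_Ioi hx, integral_image_eq_integral_abs_deriv_smul measurableSet_Ioi
    (fun t ht => hasDerivWithinAt_mobius hx ht) (injOn_mobius hx), ← integral_const_mul]
  exact setIntegral_congr_fun measurableSet_Ioi fun t ht => euler_integrand_mobius α β γ hx ht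

theorem integrableOn_beta_integrand {u v : ℂ} (hu : 0 < u.re) (hv : 0 < v.re) :
    IntegrableOn (fun x : ℝ => (x : ℂ) ^ (u - 1) * (1 - (x : ℂ)) ^ (v - 1)) (Ioo 0 1) :=
  (intervalIntegrable_iff_integrableOn_Ioo_of_le zero_le_one).1
    (Complex.betaIntegral_convergent hu hv)

theorem betaIntegral_eq_setIntegral_Ioo (u v : ℂ) :
    Complex.betaIntegral u v =
      ∫ x : ℝ in Ioo 0 1, (x : ℂ) ^ (u - 1) * (1 - (x : ℂ)) ^ (v - 1) := by
  rw [Complex.betaIntegral, intervalIntegral.integral_of_le zero_le_one,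
    integral_Ioc_eq_integral_Ioo]

theorem integrableOn_cpow_mul_sub_one_cpow {α γ : ℂ} (hα : 0 < α.re) (hγ : α.re < γ.re) :
    IntegrableOn (fun t : ℝ => (t : ℂ) ^ (-γ) * ((t : ℂ) - 1) ^ (α - 1)) (Ioi 1) := by
  have h := integrableOn_beta_integrand hα (v := γ - α) (by simpa using hγ)
  rw [← image_mobius_Ioi le_rfl, integrableOn_image_iff_integrableOn_abs_deriv_smul
    measurableSet_Ioi (fun t ht => hasDerivWithinAt_mobius le_rfl ht) (injOn_mobius le_rfl)] at h
  refine h.congr_fun (fun t ht => ?_) measurableSet_Ioi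
  simpa using euler_integrand_mobius α γ γ le_rfl ht

theorem setIntegral_cpow_mul_sub_one_cpow (α γ : ℂ) :
    ∫ t : ℝ in Ioi 1, (t : ℂ) ^ (-γ) * ((t : ℂ) - 1) ^ (α - 1) =
      Complex.betaIntegral α (γ - α) := by
  have := euler_integral_eq_loop_integral α γ γ le_rfl
  simp only [ofReal_zero, zero_mul, add_zero, Complex.one_cpow, mul_one, one_mul, sub_self,
    Complex.cpow_zero] at this
  rw [betaIntegral_eq_setIntegral_Ioo, this]

theorem mellinConvergent_one_add_cpow {b s : ℂ} (hs : 0 < s.re) (hb : s.re < b.re) :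
    MellinConvergent (fun x : ℝ => (1 + x : ℂ) ^ (-b)) s := by
  have h := integrableOn_cpow_mul_sub_one_cpow hs hb
  rw [← (measurePreserving_add_right volume (1 : ℝ)).integrableOn_comp_preimage
    (measurableEmbedding_addRight 1)] at h
  rw [MellinConvergent]
  convert! h using 1
  · ext x
    simp [mul_comm, add_comm]
  · simp

theorem mellin_one_add_cpow {b s : ℂ} (hs : 0 < s.re) (hb : s.re < b.re) :
    mellin (fun x : ℝ => (1 + x : ℂ) ^ (-b)) s =
      Complex.Gamma s * Complex.Gamma (b - s) / Complex.Gamma b := by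
  have hne : Complex.Gamma b ≠ 0 := Complex.Gamma_ne_zero_of_re_pos (hs.trans hb)
  have h := (measurePreserving_add_right volume (1 : ℝ)).setIntegral_preimage_emb
    (measurableEmbedding_addRight 1)
    (fun t : ℝ => (t : ℂ) ^ (-b) * ((t : ℂ) - 1) ^ (s - 1)) (Ioi 1)
  rw [setIntegral_cpow_mul_sub_one_cpow] at h
  rw [Complex.Gamma_mul_Gamma_eq_betaIntegral hs (by simpa using hb), add_sub_cancel,
    mul_div_cancel_left₀ _ hne, ← h, mellin]
  simp [mul_comm, add_comm]

theorem continuous_Gamma_vertical {f : ℝ → ℂ} (hf : Continuous f) (h : ∀ y, 0 < (f y).re) :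
    Continuous fun y => Complex.Gamma (f y) := by
  refine continuous_iff_continuousAt.2 fun y => ?_
  refine ContinuousAt.comp (g := Complex.Gamma) ?_ hf.continuousAt
  refine (Complex.differentiableAt_Gamma _ fun m hm => ?_).continuousAt
  have := h y
  rw [hm] at this
  simp only [neg_re, natCast_re, Left.neg_pos_iff] at this
  exact absurd this (not_lt.2 m.cast_nonneg)

theorem integrable_Gamma_mul_Gamma {β : ℂ} {ε : ℝ} (hε : 0 < ε) (hβ : ε < β.re) :
    Integrable fun y : ℝ => Complex.Gamma (ε - I * y) * Complex.Gamma (β - ε + I * y) := by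
  obtain ⟨C, -, hC⟩ := exists_norm_Gamma_mul_Gamma_le hε hβ (θ := 1 / 2) (by norm_num)
    (by linarith [Real.pi_gt_three])
  refine ((integrable_exp_neg_mul_abs (δ := 2 * (1 / 2)) (by norm_num)).const_mul C).mono'
    ?_ (Eventually.of_forall hC)
  refine Continuous.aestronglyMeasurable ?_
  exact (continuous_Gamma_vertical (by fun_prop) (by simp [hε])).mul
    (continuous_Gamma_vertical (by fun_prop) (by simp [hβ]))

/-- The Mellin–Barnes representation of `(1 + x) ^ (-β)`. -/
theorem integral_cpow_mul_Gamma_mul_Gamma {β : ℂ} {ε x : ℝ} (hε : 0 < ε) (hβ : ε < β.re)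
    (hx : 0 < x) :
    ∫ y : ℝ, (x : ℂ) ^ (-(ε : ℂ) + I * y) *
        (Complex.Gamma (ε - I * y) * Complex.Gamma (β - ε + I * y)) =
      2 * π * (Complex.Gamma β * (1 + x : ℂ) ^ (-β)) := by
  have hne : Complex.Gamma β ≠ 0 := Complex.Gamma_ne_zero_of_re_pos (hε.trans hβ)
  have hmel : ∀ y : ℝ, mellin (fun x : ℝ => (1 + x : ℂ) ^ (-β)) (ε + y * I) =
      Complex.Gamma (ε - I * (-y : ℝ)) * Complex.Gamma (β - ε + I * (-y : ℝ)) /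
        Complex.Gamma β := by
    intro y
    rw [mellin_one_add_cpow (by simpa using hε) (by simpa using hβ)]
    congr 3 <;> push_cast <;> ring
  have hvert : VerticalIntegrable (mellin fun x : ℝ => (1 + x : ℂ) ^ (-β)) ε := by
    rw [VerticalIntegrable]
    simp only [hmel]
    exact (integrable_Gamma_mul_Gamma hε hβ).comp_neg.div_const _
  have hcont : ContinuousAt (fun x : ℝ => (1 + x : ℂ) ^ (-β)) x := by
    refine ContinuousAt.cpow (by fun_prop) continuousAt_const (Or.inl ?_)
    simp only [add_re, one_re, ofReal_re]
    linarith
  have h := mellinInv_mellin_eq ε _ hx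
    (mellinConvergent_one_add_cpow (b := β) (by simpa using hε) (by simpa using hβ)) hvert hcont
  rw [mellinInv, ← integral_neg_eq_self] at h
  simp only [hmel, neg_neg, smul_eq_mul, Complex.real_smul] at h
  have hrw : ∀ y : ℝ, (x : ℂ) ^ (-((ε : ℂ) + (-y : ℝ) * I)) *
      (Complex.Gamma (ε - I * y) * Complex.Gamma (β - ε + I * y) / Complex.Gamma β) =
      (Complex.Gamma β)⁻¹ * ((x : ℂ) ^ (-(ε : ℂ) + I * y) *
        (Complex.Gamma (ε - I * y) * Complex.Gamma (β - ε + I * y))) := by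
    intro y
    rw [show -((ε : ℂ) + (-y : ℝ) * I) = -(ε : ℂ) + I * y by push_cast; ring]
    ring
  simp only [hrw, integral_const_mul] at h
  rw [← h]
  push_cast
  field_simp [hne, ofReal_ne_zero.2 Real.pi_ne_zero]

theorem Gamma_div_Gamma_eq_betaIntegral {a c : ℂ} (ha : 0 < a.re) (hc : a.re < c.re) :
    Complex.Gamma a / Complex.Gamma c =
      Complex.betaIntegral a (c - a) / Complex.Gamma (c - a) := by
  have h := Complex.Gamma_mul_Gamma_eq_betaIntegral ha (t := c - a) (by simpa using hc)
  rw [add_sub_cancel] at h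
  rw [div_eq_div_iff (Complex.Gamma_ne_zero_of_re_pos (ha.trans hc))
    (Complex.Gamma_ne_zero_of_re_pos (by simpa using hc)), h, mul_comm]

theorem norm_beta_integrand (u v : ℂ) {x : ℝ} (hx : x ∈ Ioo (0 : ℝ) 1) :
    ‖(x : ℂ) ^ (u - 1) * (1 - (x : ℂ)) ^ (v - 1)‖ =
      x ^ (u.re - 1) * (1 - x) ^ (v.re - 1) := by
  have h1 : 0 < 1 - x := sub_pos.2 hx.2
  rw [norm_mul, Complex.norm_cpow_eq_rpow_re_of_pos hx.1, ← ofReal_one, ← ofReal_sub,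
    Complex.norm_cpow_eq_rpow_re_of_pos h1]
  simp

theorem exists_norm_Gamma_div_Gamma_le {α γ : ℂ} {ε : ℝ} (hα : ε < α.re) (hγ : α.re < γ.re) :
    ∃ C : ℝ, 0 ≤ C ∧ ∀ y : ℝ,
      ‖Complex.Gamma (α - ε + I * y) / Complex.Gamma (γ - ε + I * y)‖ ≤ C := by
  set J : ℝ := ∫ x in Ioo (0 : ℝ) 1, x ^ (α.re - ε - 1) * (1 - x) ^ ((γ - α).re - 1) with hJ
  have hJ0 : 0 ≤ J := setIntegral_nonneg measurableSet_Ioo fun x hx =>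
    mul_nonneg (Real.rpow_nonneg hx.1.le _) (Real.rpow_nonneg (sub_nonneg.2 hx.2.le) _)
  refine ⟨J / ‖Complex.Gamma (γ - α)‖, by positivity, fun y => ?_⟩
  rw [Gamma_div_Gamma_eq_betaIntegral (by simpa using hα) (by simpa using hγ),
    show γ - ε + I * y - (α - ε + I * y) = γ - α by ring, norm_div]
  gcongr
  rw [betaIntegral_eq_setIntegral_Ioo]
  refine (norm_integral_le_integral_norm _).trans_eq ?_
  refine setIntegral_congr_fun measurableSet_Ioo fun x hx => ?_
  simp only [norm_beta_integrand _ _ hx]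
  simp

/-- The Barnes integral on the line `Im μ = π`, as an Euler integral. -/
theorem BarnesB_eq_euler_integral {α β γ : ℂ} {ε m : ℝ}
    (hγα : α.re < γ.re) (hα : ε < α.re) (hβ : ε < β.re) (hε : 0 < ε) :
    BarnesB α β γ (m + π * I) ε =
      Complex.Gamma β / Complex.Gamma (γ - α) * ∫ u : ℝ in Ioo 0 1,
        (u : ℂ) ^ (α - 1) * (1 - (u : ℂ)) ^ (γ - α - 1) *
          (1 + (rexp m : ℝ) * (u : ℂ)) ^ (-β) := by
  set x : ℝ := rexp m with hxdef
  have hx : 0 < x := Real.exp_pos m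
  set G : ℝ → ℂ := fun y => Complex.Gamma (ε - I * y) * Complex.Gamma (β - ε + I * y) with hG
  set w : ℝ → ℂ := fun u => (u : ℂ) ^ (α - 1) * (1 - (u : ℂ)) ^ (γ - α - 1) with hw
  set H : ℝ → ℝ → ℂ := fun y u => ((x * u : ℝ) : ℂ) ^ (-(ε : ℂ) + I * y) * G y * w u with hH
  have hintegrand : ∀ y : ℝ,
      Complex.exp ((-(ε : ℂ) + I * y) * ((m + π * I : ℂ) - π * I)) *
        Complex.Gamma (ε - I * y) * Complex.Gamma (α - ε + I * y) *
        Complex.Gamma (β - ε + I * y) / Complex.Gamma (γ - ε + I * y) =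
      (Complex.Gamma (γ - α))⁻¹ * ∫ u in Ioo (0 : ℝ) 1, H y u := by
    intro y
    have hexp : Complex.exp ((-(ε : ℂ) + I * y) * ((m + π * I : ℂ) - π * I)) =
        (x : ℂ) ^ (-(ε : ℂ) + I * y) := by
      rw [ofReal_cpow_eq_exp hx, hxdef, Real.log_exp, add_sub_cancel_right]
    have hmul : ∫ u in Ioo (0 : ℝ) 1, H y u = ((x : ℂ) ^ (-(ε : ℂ) + I * y) * G y) *
        Complex.betaIntegral (α - ε + I * y) (γ - α) := by
      rw [betaIntegral_eq_setIntegral_Ioo, ← integral_const_mul]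
      refine setIntegral_congr_fun measurableSet_Ioo fun u hu => ?_
      have hu' : (u : ℂ) ≠ 0 := ofReal_ne_zero.2 hu.1.ne'
      simp only [hH, hw]
      rw [ofReal_mul, Complex.mul_cpow_ofReal_nonneg hx.le hu.1.le,
        show α - ε + I * y - 1 = (-(ε : ℂ) + I * y) + (α - 1) by ring,
        Complex.cpow_add (-(ε : ℂ) + I * y) (α - 1) hu']
      ring
    have hdiv := Gamma_div_Gamma_eq_betaIntegral (a := α - ε + I * y) (c := γ - ε + I * y)
      (by simpa using hα) (by simpa using hγα)
    rw [show γ - ε + I * y - (α - ε + I * y) = γ - α by ring] at hdiv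
    rw [hexp, hmul]
    calc _ = (x : ℂ) ^ (-(ε : ℂ) + I * y) * G y *
          (Complex.Gamma (α - ε + I * y) / Complex.Gamma (γ - ε + I * y)) := by
          simp only [hG]; ring
      _ = _ := by rw [hdiv]; ring
  have hint : Integrable (Function.uncurry H)
      ((volume : Measure ℝ).prod (volume.restrict (Ioo (0 : ℝ) 1))) := by
    have hQ := integrableOn_beta_integrand (u := α - ε) (v := γ - α) (by simpa using hα)
      (by simpa using hγα)
    have hP := (integrable_Gamma_mul_Gamma hε hβ).norm.const_mul (x ^ (-ε))
    have hPQ := hP.mul_prod hQ.norm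
    refine hPQ.mono' ?_ ?_
    · have hGc : AEStronglyMeasurable G volume := (integrable_Gamma_mul_Gamma hε hβ).1
      refine AEStronglyMeasurable.mul (AEStronglyMeasurable.mul ?_ hGc.comp_fst) ?_
      · refine Measurable.aestronglyMeasurable ?_
        fun_prop
      · refine AEStronglyMeasurable.comp_snd (f := w) ?_
        refine Measurable.aestronglyMeasurable ?_
        fun_prop
    · have hae : ∀ᵐ p : ℝ × ℝ ∂((volume : Measure ℝ).prod (volume.restrict (Ioo (0 : ℝ) 1))),
          p.2 ∈ Ioo (0 : ℝ) 1 :=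
        Measure.quasiMeasurePreserving_snd.ae (ae_restrict_mem measurableSet_Ioo)
      filter_upwards [hae] with p hp
      simp only [Function.uncurry, hH, hw]
      rw [norm_mul, norm_mul, norm_beta_integrand _ _ hp, norm_beta_integrand _ _ hp,
        Complex.norm_cpow_eq_rpow_re_of_pos (mul_pos hx hp.1),
        show (-(ε : ℂ) + I * p.1).re = -ε by simp, Real.mul_rpow hx.le hp.1.le,
        show (α - (ε : ℂ)).re - 1 = -ε + (α.re - 1) by simp; ring, Real.rpow_add hp.1]
      apply le_of_eq
      ring
  have hswap : ∫ y : ℝ, ∫ u in Ioo (0 : ℝ) 1, H y u =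
      2 * π * Complex.Gamma β * ∫ u in Ioo (0 : ℝ) 1, w u * (1 + x * (u : ℂ)) ^ (-β) := by
    rw [integral_integral_swap hint, ← integral_const_mul]
    refine setIntegral_congr_fun measurableSet_Ioo fun u hu => ?_
    simp only [hH]
    rw [integral_mul_const, integral_cpow_mul_Gamma_mul_Gamma hε hβ (mul_pos hx hu.1)]
    push_cast
    ring
  simp only [BarnesB, hintegrand, integral_const_mul, hswap]
  field_simp [ofReal_ne_zero.2 Real.pi_ne_zero]
  rfl

theorem isOpen_im_strip : IsOpen {z : ℂ | 0 < z.im ∧ z.im < 2 * π} :=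
  (isOpen_lt continuous_const Complex.continuous_im).inter
    (isOpen_lt Complex.continuous_im continuous_const)

theorem differentiableOn_BarnesB {α β γ : ℂ} {ε : ℝ}
    (hγα : α.re < γ.re) (hα : ε < α.re) (hβ : ε < β.re) (hε : 0 < ε) :
    DifferentiableOn ℂ (fun μ => BarnesB α β γ μ ε) {z : ℂ | 0 < z.im ∧ z.im < 2 * π} := by
  refine DifferentiableOn.const_mul ?_ _
  refine differentiableOn_integral_of_locally_dominated isOpen_im_strip (fun μ _ => ?_)
    (Eventually.of_forall fun y => by fun_prop) fun μ₀ hμ₀ => ?_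
  · refine Continuous.aestronglyMeasurable ?_
    refine Continuous.div ?_ (continuous_Gamma_vertical (by fun_prop) fun y => ?_) fun y => ?_
    · refine (((by fun_prop : Continuous fun y : ℝ =>
        Complex.exp ((-(ε : ℂ) + I * y) * (μ - π * I))).mul ?_).mul ?_).mul ?_ <;>
      exact continuous_Gamma_vertical (by fun_prop) fun y => by simp [*]
    · simpa using hα.trans hγα
    · exact Complex.Gamma_ne_zero_of_re_pos (by simpa using hα.trans hγα)
  · obtain ⟨hμ0, hμ1⟩ := hμ₀
    obtain ⟨κ, hκ0, hκ⟩ := exists_between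
      (abs_lt.2 ⟨by linarith, by linarith⟩ : |μ₀.im - π| < π)
    have hκ' : 0 ≤ κ := (abs_nonneg _).trans hκ0.le
    obtain ⟨C₁, hC₁, h₁⟩ := exists_norm_Gamma_mul_Gamma_le hε hβ (θ := (κ + π) / 4)
      (by linarith) (by linarith)
    obtain ⟨C₂, hC₂, h₂⟩ := exists_norm_Gamma_div_Gamma_le hα hγα
    have hV : IsOpen {z : ℂ | |z.im - π| < κ ∧ μ₀.re - 1 < z.re} :=
      (isOpen_lt (Complex.continuous_im.sub continuous_const).abs continuous_const).inter
        (isOpen_lt continuous_const Complex.continuous_re)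
    refine ⟨_, hV.mem_nhds ⟨hκ0, by linarith⟩,
      fun y => rexp (ε * (1 - μ₀.re)) * C₁ * C₂ * rexp (-((π - κ) / 2) * |y|),
      (integrable_exp_neg_mul_abs (by linarith)).const_mul _,
      Eventually.of_forall fun y μ hμ => ?_⟩
    obtain ⟨hμi, hμr⟩ := hμ
    have hexp : ‖Complex.exp ((-(ε : ℂ) + I * y) * (μ - π * I))‖ ≤
        rexp (ε * (1 - μ₀.re) + κ * |y|) := by
      rw [Complex.norm_exp]
      gcongr
      have h3 : |y * (μ.im - π)| ≤ κ * |y| := by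
        rw [abs_mul, mul_comm]
        gcongr
      have h4 := neg_le_of_abs_le h3
      have h5 : ((-(ε : ℂ) + I * y) * (μ - π * I)).re = -ε * μ.re - y * (μ.im - π) := by simp
      rw [h5]
      nlinarith
    calc _ = ‖Complex.exp ((-(ε : ℂ) + I * y) * (μ - π * I))‖ *
          ‖Complex.Gamma (ε - I * y) * Complex.Gamma (β - ε + I * y)‖ *
          ‖Complex.Gamma (α - ε + I * y) / Complex.Gamma (γ - ε + I * y)‖ := by
          simp only [norm_mul, norm_div]; ring
      _ ≤ rexp (ε * (1 - μ₀.re) + κ * |y|) * (C₁ * rexp (-(2 * ((κ + π) / 4)) * |y|)) * C₂ := by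
          gcongr
          · exact h₁ y
          · exact h₂ y
      _ = _ := by
          beta_reduce
          rw [show -((π - κ) / 2) * |y| = κ * |y| + -(2 * ((κ + π) / 4)) * |y| by ring,
            Real.exp_add, Real.exp_add]
          ring

theorem aestronglyMeasurable_loop_integrand (α β γ z : ℂ) (ν : Measure ℝ) :
    AEStronglyMeasurable (fun t : ℝ =>
      (t : ℂ) ^ (-β) * ((t : ℂ) - 1) ^ (α - 1) * ((t : ℂ) - z) ^ (β - γ)) ν :=
  Measurable.aestronglyMeasurable (by fun_prop)

theorem exists_norm_loop_integrand_le (α β γ : ℂ) {z₀ : ℂ} (hz₀ : 1 - z₀ ∈ slitPlane) :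
    ∃ V ∈ 𝓝 z₀, ∃ C : ℝ, ∀ᵐ t : ℝ ∂volume.restrict (Ioi 1), ∀ z ∈ V,
      ‖(t : ℂ) ^ (-β) * ((t : ℂ) - 1) ^ (α - 1) * ((t : ℂ) - z) ^ (β - γ)‖ ≤
        C * ‖(t : ℂ) ^ (-γ) * ((t : ℂ) - 1) ^ (α - 1)‖ := by
  obtain ⟨V, hV, C, -, hC⟩ := exists_norm_ofReal_sub_cpow_le (β - γ) hz₀
  refine ⟨V, hV, C, ?_⟩
  filter_upwards [ae_restrict_mem measurableSet_Ioi] with t ht z hz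
  have ht : 1 < t := ht
  have ht0 : 0 < t := by linarith
  rw [show -γ = -β + (β - γ) by ring, Complex.cpow_add _ _ (ofReal_ne_zero.2 ht0.ne'),
    norm_mul, norm_mul, norm_mul, norm_mul, Complex.norm_cpow_eq_rpow_re_of_pos ht0 (β - γ)]
  calc _ ≤ ‖(t : ℂ) ^ (-β)‖ * ‖((t : ℂ) - 1) ^ (α - 1)‖ * (C * t ^ (β - γ).re) := by
        gcongr
        exact hC z hz t ht.le
    _ = _ := by ring

theorem integrableOn_loop_integrand {α γ : ℂ} (β : ℂ) (hγα : α.re < γ.re) (hα : 0 < α.re)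
    {z : ℂ} (hz : 1 - z ∈ slitPlane) :
    IntegrableOn (fun t : ℝ =>
      (t : ℂ) ^ (-β) * ((t : ℂ) - 1) ^ (α - 1) * ((t : ℂ) - z) ^ (β - γ)) (Ioi 1) := by
  obtain ⟨V, hV, C, hC⟩ := exists_norm_loop_integrand_le α β γ hz
  refine ((integrableOn_cpow_mul_sub_one_cpow hα hγα).norm.const_mul C).mono'
    (aestronglyMeasurable_loop_integrand α β γ z _) ?_
  filter_upwards [hC] with t ht using ht z (mem_of_mem_nhds hV)

theorem differentiableOn_loop_integral {α γ : ℂ} (β : ℂ) (hγα : α.re < γ.re) (hα : 0 < α.re) :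
    DifferentiableOn ℂ (fun z : ℂ => ∫ t : ℝ in Ioi 1,
      (t : ℂ) ^ (-β) * ((t : ℂ) - 1) ^ (α - 1) * ((t : ℂ) - z) ^ (β - γ))
      {z : ℂ | 1 - z ∈ slitPlane} := by
  refine differentiableOn_integral_of_locally_dominated
    (isOpen_slitPlane.preimage (by fun_prop : Continuous fun z : ℂ => 1 - z))
    (fun z _ => aestronglyMeasurable_loop_integrand α β γ z _) ?_ fun z₀ hz₀ => ?_
  · filter_upwards [ae_restrict_mem measurableSet_Ioi] with t ht z hz
    exact (((differentiableAt_id.const_sub _).cpow_const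
      (ofReal_sub_mem_slitPlane hz (le_of_lt ht))).const_mul _).differentiableWithinAt
  · obtain ⟨V, hV, C, hC⟩ := exists_norm_loop_integrand_le α β γ hz₀
    exact ⟨V, hV, _, (integrableOn_cpow_mul_sub_one_cpow hα hγα).norm.const_mul C, hC⟩

theorem one_sub_exp_mem_slitPlane {μ : ℂ} (h0 : 0 < μ.im) (h1 : μ.im < 2 * π) :
    1 - Complex.exp μ ∈ slitPlane := by
  rw [Complex.mem_slitPlane_iff, sub_re, sub_im, Complex.exp_re, Complex.exp_im, one_re, one_im,
    zero_sub, neg_ne_zero]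
  have he := Real.exp_pos μ.re
  rcases lt_trichotomy μ.im π with h | h | h
  · exact Or.inr (mul_pos he (Real.sin_pos_of_pos_of_lt_pi h0 h)).ne'
  · left
    rw [h, Real.cos_pi]
    linarith
  · refine Or.inr (mul_ne_zero he.ne' ?_)
    have := Real.sin_pos_of_pos_of_lt_pi (x := μ.im - π) (by linarith) (by linarith)
    rw [Real.sin_sub_pi] at this
    linarith

/-- The Barnes integral equals
`(1−e^μ)^{γ−α−β} (Γ(β)/Γ(γ−α)) ∫_{1}^{∞} t^{−β} (t−1)^{α−1} (t−e^μ)^{β−γ} dt`,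
the integral on the right converging absolutely. -/
theorem barnes_integral_eq_loop_integral
    (α β γ μ : ℂ) (ε : ℝ)
    (hγα : α.re < γ.re) (hα : 0 < α.re) (hβ : 0 < β.re)
    (hε0 : 0 < ε) (hε : ε < min α.re β.re)
    (hμim0 : 0 < μ.im) (hμim : μ.im < 2 * π) :
    IntegrableOn (fun t : ℝ =>
      (t : ℂ) ^ (-β) * ((t : ℂ) - 1) ^ (α - 1) *
        ((t : ℂ) - Complex.exp μ) ^ (β - γ)) (Set.Ioi 1) ∧
    BarnesB α β γ μ ε =
      (1 - Complex.exp μ) ^ (γ - α - β) * (Complex.Gamma β / Complex.Gamma (γ - α)) *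
        ∫ t : ℝ in Set.Ioi 1,
          (t : ℂ) ^ (-β) * ((t : ℂ) - 1) ^ (α - 1) *
            ((t : ℂ) - Complex.exp μ) ^ (β - γ) := by
  obtain ⟨hεα, hεβ⟩ := lt_min_iff.1 hε
  refine ⟨integrableOn_loop_integrand β hγα hα (one_sub_exp_mem_slitPlane hμim0 hμim), ?_⟩
  have hmaps : MapsTo Complex.exp {z : ℂ | 0 < z.im ∧ z.im < 2 * π}
      {z : ℂ | 1 - z ∈ slitPlane} := fun z hz => one_sub_exp_mem_slitPlane hz.1 hz.2
  have hdiff : DifferentiableOn ℂ (fun μ : ℂ =>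
      (1 - Complex.exp μ) ^ (γ - α - β) * (Complex.Gamma β / Complex.Gamma (γ - α)) *
        ∫ t : ℝ in Set.Ioi 1, (t : ℂ) ^ (-β) * ((t : ℂ) - 1) ^ (α - 1) *
            ((t : ℂ) - Complex.exp μ) ^ (β - γ)) {z : ℂ | 0 < z.im ∧ z.im < 2 * π} := by
    refine DifferentiableOn.mul (DifferentiableOn.mul_const (fun z hz => ?_) _)
      ((differentiableOn_loop_integral β hγα hα).comp Complex.differentiable_exp.differentiableOn
        hmaps)
    exact ((Complex.differentiableAt_exp.const_sub _).cpow_const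
      (hmaps hz)).differentiableWithinAt
  have hconv : Convex ℝ {z : ℂ | 0 < z.im ∧ z.im < 2 * π} :=
    (convex_halfSpace_im_gt 0).inter (convex_halfSpace_im_lt (2 * π))
  refine eqOn_of_eq_on_real_line isOpen_im_strip hconv.isPreconnected
    (differentiableOn_BarnesB hγα hεα hεβ hε0) hdiff (z₀ := π * I) (v := 1)
    (by simp [Real.pi_pos]) one_ne_zero (fun m _ => ?_) ⟨hμim0, hμim⟩
  have hexp : Complex.exp (m + π * I) = -((rexp m : ℝ) : ℂ) := by
    rw [Complex.exp_add, Complex.exp_pi_mul_I, ofReal_exp]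
    ring
  rw [mul_one, add_comm (π * I : ℂ)]
  simp only [hexp, sub_neg_eq_add]
  rw [BarnesB_eq_euler_integral hγα hεα hεβ hε0,
    euler_integral_eq_loop_integral α β γ (Real.exp_pos m).le]
  ring
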